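/- There exists an absolute constant C > 0 such that for every integer m ≥ 2 and every function F : 𝓛_m → ℓ^p the following Poincaré inequalities hold: (i) if 1 ≤ p ≤ 2, then Σ_{u,v ∈ 𝓛_m} ‖F(u)−F(v)‖_p^p U_m(u) U_m(v) ≤ C m log m · Σ_{u,v ∈ 𝓛_m} ‖F(u)−F(v)‖_p^p U_m(u) 𝔭_m(u,v); (ii) if p > 2, then Σ_{u,v ∈ 𝓛_m} ‖F(u)−F(v)‖_p^p U_m(u) U_m(v) ≤ (C m log m)^{p/2} (2p)^p · Σ_{u,v ∈ 𝓛_m} ‖F(u)−F(v)‖_p^p U_m(u) 𝔭_m(u,v). -/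

import Mathlib

open scoped BigOperators ENNReal

noncomputable section

/-- The conductances 1/(1+|x-x'|²)` on the segment `I_m = {0,…,m-1}`. -/
def conduct (m : ℕ) (x x' : Fin m) : ℝ :=
  1 / (1 + ((x : ℤ) - (x' : ℤ)) ^ 2)

/-- The Cauchy-like Markov kernel `ζ_m` on `I_m`. -/
def zeta (m : ℕ) (x x' : Fin m) : ℝ :=
  conduct m x x' / ∑ y, conduct m x y

/-- The lamplighter set `𝓛_m = {0,1}^{I_m} × I_m` over the segment `I_m`. -/
abbrev Lamp (m : ℕ) := (Fin m → Bool) × Fin m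

open Classical in
/-- The lamplighter Markov kernel `𝔭_m` on `𝓛_m`: randomize the lamp at the current
position, move according to `ζ_m`, and randomize the lamp at the new position. -/
def pker (m : ℕ) (u v : Lamp m) : ℝ :=
  if u.2 ≠ v.2 ∧ (∀ z, z ≠ u.2 → z ≠ v.2 → u.1 z = v.1 z) then (1 / 4) * zeta m u.2 v.2
  else if u.2 = v.2 ∧ (∀ z, z ≠ u.2 → u.1 z = v.1 z) then (1 / 2) * zeta m u.2 u.2
  else 0

/-- The stationary distribution `𝒞_m` of `ζ_m` on `I_m`. -/
def statBase (m : ℕ) (x : Fin m) : ℝ :=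
  (∑ x', conduct m x x') / ∑ z, ∑ z', conduct m z z'

/-- The stationary distribution `U_m(f,x) = 2^{-m} 𝒞_m(x)` of `𝔭_m` on `𝓛_m`. -/
def Um (m : ℕ) (u : Lamp m) : ℝ :=
  (1 / 2 : ℝ) ^ m * statBase m u.2


/-! ### Part A: effective resistance bound on the segment -/

/-- conductances on the naturals -/
def wt (a b : ℕ) : ℝ := 1 / (1 + ((a : ℝ) - b) ^ 2)

lemma wt_nonneg (a b : ℕ) : 0 ≤ wt a b := by unfold wt; positivity

/-- unnormalised energy -/
def En (m : ℕ) (H : ℕ → ℝ) : ℝ :=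
  ∑ a ∈ Finset.range m, ∑ b ∈ Finset.range m, wt a b * (H a - H b) ^ 2

lemma block_le (H : ℕ → ℝ) (S T : Finset ℕ) (s t M : ℝ) (hs : 0 < s) (ht : 0 < t)
    (hS : (S.card : ℝ) = s) (hT : (T.card : ℝ) = t)
    (hw : ∀ a ∈ S, ∀ b ∈ T, 1 ≤ M * (s * t) * wt a b) :
    ((∑ a ∈ S, H a) / s - (∑ b ∈ T, H b) / t) ^ 2 ≤
      M * ∑ a ∈ S, ∑ b ∈ T, wt a b * (H a - H b) ^ 2 := by
  have h1 : (∑ a ∈ S, H a) / s - (∑ b ∈ T, H b) / t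
      = (∑ q ∈ S ×ˢ T, (H q.1 - H q.2)) / (s * t) := by
    rw [Finset.sum_product]
    simp only [Finset.sum_sub_distrib, Finset.sum_const, nsmul_eq_mul, hS, hT]
    rw [← Finset.mul_sum]
    field_simp
  have h2 := sq_sum_le_card_mul_sum_sq (s := S ×ˢ T) (f := fun q => H q.1 - H q.2)
  rw [Finset.card_product, Nat.cast_mul, hS, hT] at h2
  rw [h1, div_pow, div_le_iff₀ (by positivity)]
  have h3 : ∑ q ∈ S ×ˢ T, (H q.1 - H q.2) ^ 2 ≤
      M * (s * t) * ∑ a ∈ S, ∑ b ∈ T, wt a b * (H a - H b) ^ 2 := by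
    rw [Finset.sum_product, Finset.mul_sum]
    refine Finset.sum_le_sum fun a ha => ?_
    rw [Finset.mul_sum]
    refine Finset.sum_le_sum fun b hb => ?_
    have := mul_le_mul_of_nonneg_right (hw a ha b hb) (sq_nonneg (H a - H b))
    linarith
  have h4 := mul_le_mul_of_nonneg_left h3 (by positivity : (0:ℝ) ≤ s * t)
  calc _ ≤ _ := h2
    _ ≤ _ := h4
    _ = _ := by ring

/-- dyadic block to the right of `x` -/
def blk (x k : ℕ) : Finset ℕ := Finset.Ico (x + 2 ^ k - 1) (x + 2 ^ (k + 1) - 1)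

lemma blk_card (x k : ℕ) : ((blk x k).card : ℝ) = 2 ^ k := by
  have : (blk x k).card = 2 ^ k := by
    have h := Nat.one_le_two_pow (n := k)
    simp only [blk, Nat.card_Ico, pow_succ]
    omega
  rw [this]; push_cast; rfl

/-- block average -/
def bavg (H : ℕ → ℝ) (x k : ℕ) : ℝ := (∑ a ∈ blk x k, H a) / 2 ^ k

lemma wt_lower (a b : ℕ) (D : ℝ) (h1 : (a : ℝ) - b ≤ D) (h2 : (b : ℝ) - a ≤ D) :
    1 ≤ (1 + D ^ 2) * wt a b := by
  unfold wt
  rw [mul_one_div, le_div_iff₀ (by positivity)]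
  nlinarith

lemma bavg_step (H : ℕ → ℝ) (x k : ℕ) :
    (bavg H x k - bavg H x (k + 1)) ^ 2 ≤
      5 * ∑ a ∈ blk x k, ∑ b ∈ blk x (k + 1), wt a b * (H a - H b) ^ 2 := by
  refine block_le H _ _ _ _ 5 (by positivity) (by positivity) (blk_card x k)
    (blk_card x (k + 1)) ?_
  intro a ha b hb
  simp only [blk, Finset.mem_Ico] at ha hb
  have hk := Nat.one_le_two_pow (n := k)
  have hk' : (1 : ℝ) ≤ 2 ^ k := by exact_mod_cast hk
  have e1 : 2 ^ (k + 1) = 2 * 2 ^ k := by ring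
  have e2 : 2 ^ (k + 1 + 1) = 4 * 2 ^ k := by ring
  rw [e1] at ha hb
  rw [e2] at hb
  have h1 : (b : ℝ) ≤ a + 3 * 2 ^ k := by
    have : b ≤ a + 3 * 2 ^ k := by omega
    exact_mod_cast this
  have h2 : (a : ℝ) ≤ b := by
    have : a ≤ b := by omega
    exact_mod_cast this
  have h3 := wt_lower a b (3 * 2 ^ k) (by linarith) (by linarith)
  refine h3.trans (mul_le_mul_of_nonneg_right ?_ (wt_nonneg a b))
  have e3 : (2 : ℝ) ^ (k + 1) = 2 * 2 ^ k := by ring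
  rw [e3]
  nlinarith

lemma bavg_tel (H : ℕ → ℝ) (x m K : ℕ) (h : x + 2 ^ (K + 1) - 1 ≤ m) :
    ∑ k ∈ Finset.range K, (bavg H x k - bavg H x (k + 1)) ^ 2 ≤
      5 * ∑ a ∈ Finset.Ico x (x + 2 ^ K - 1), ∑ b ∈ Finset.range m,
        wt a b * (H a - H b) ^ 2 := by
  induction K with
  | zero => simp
  | succ K ih =>
    have hk := Nat.one_le_two_pow (n := K)
    have e1 : 2 ^ (K + 1) = 2 * 2 ^ K := by ring
    have e2 : 2 ^ (K + 1 + 1) = 4 * 2 ^ K := by ring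
    have ih' := ih (by omega)
    rw [Finset.sum_range_succ,
      ← Finset.sum_Ico_consecutive _ (show x ≤ x + 2 ^ K - 1 by omega)
        (show x + 2 ^ K - 1 ≤ x + 2 ^ (K + 1) - 1 by omega), mul_add]
    refine add_le_add ih' ((bavg_step H x K).trans ?_)
    refine mul_le_mul_of_nonneg_left ?_ (by norm_num)
    refine Finset.sum_le_sum fun a _ => ?_
    refine Finset.sum_le_sum_of_subset_of_nonneg ?_ ?_
    · intro b hb
      simp only [blk, Finset.mem_Ico, Finset.mem_range] at hb ⊢
      omega
    · intro b _ _
      exact mul_nonneg (wt_nonneg a b) (sq_nonneg _)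

lemma bavg_right (H : ℕ → ℝ) (x m K : ℕ) (h : x + 2 ^ (K + 1) - 1 ≤ m) :
    (H x - bavg H x K) ^ 2 ≤ 5 * K * En m H := by
  have h0 : H x = bavg H x 0 := by simp [bavg, blk]
  have h1 : H x - bavg H x K = ∑ k ∈ Finset.range K, (bavg H x k - bavg H x (k + 1)) := by
    rw [Finset.sum_range_sub', h0]
  have h2 := sq_sum_le_card_mul_sum_sq (s := Finset.range K)
    (f := fun k => bavg H x k - bavg H x (k + 1))
  rw [Finset.card_range] at h2
  have hk := Nat.one_le_two_pow (n := K)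
  have e1 : 2 ^ (K + 1) = 2 * 2 ^ K := by ring
  have h3 : ∑ a ∈ Finset.Ico x (x + 2 ^ K - 1), ∑ b ∈ Finset.range m,
        wt a b * (H a - H b) ^ 2 ≤ En m H := by
    refine Finset.sum_le_sum_of_subset_of_nonneg ?_ ?_
    · intro b hb
      simp only [Finset.mem_Ico, Finset.mem_range] at hb ⊢
      omega
    · intro a _ _
      exact Finset.sum_nonneg fun b _ => mul_nonneg (wt_nonneg a b) (sq_nonneg _)
  have h4 := bavg_tel H x m K h
  rw [h1]
  have h5 : (0 : ℝ) ≤ K := by positivity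
  calc _ ≤ _ := h2
    _ ≤ (K : ℝ) * (5 * En m H) := mul_le_mul_of_nonneg_left (by linarith) h5
    _ = _ := by ring

lemma En_nonneg (m : ℕ) (H : ℕ → ℝ) : 0 ≤ En m H :=
  Finset.sum_nonneg fun a _ => Finset.sum_nonneg fun b _ =>
    mul_nonneg (wt_nonneg a b) (sq_nonneg _)

lemma En_reflect (m : ℕ) (H : ℕ → ℝ) : En m (fun n => H (m - 1 - n)) = En m H := by
  unfold En
  rw [← Finset.sum_range_reflect (fun a => ∑ b ∈ Finset.range m, wt a b * (H a - H b) ^ 2)]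
  refine Finset.sum_congr rfl fun a ha => ?_
  rw [← Finset.sum_range_reflect (fun b => wt (m - 1 - a) b * (H (m - 1 - a) - H b) ^ 2)]
  refine Finset.sum_congr rfl fun b hb => ?_
  rw [Finset.mem_range] at ha hb
  congr 1
  unfold wt
  have ea : ((m - 1 - a : ℕ) : ℝ) = (m : ℝ) - 1 - a := by
    rw [Nat.cast_sub (by omega), Nat.cast_sub (by omega)]; simp
  have eb : ((m - 1 - b : ℕ) : ℝ) = (m : ℝ) - 1 - b := by
    rw [Nat.cast_sub (by omega), Nat.cast_sub (by omega)]; simp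
  rw [ea, eb]
  congr 2
  ring

lemma bavg_left (H : ℕ → ℝ) (y m K : ℕ) (hy : y < m) (h : 2 ^ (K + 1) - 1 ≤ y + 1) :
    (H y - (∑ a ∈ Finset.Ico (y + 2 - 2 ^ (K + 1)) (y + 2 - 2 ^ K), H a) / 2 ^ K) ^ 2
      ≤ 5 * K * En m H := by
  have hk := Nat.one_le_two_pow (n := K)
  have e1 : 2 ^ (K + 1) = 2 * 2 ^ K := by ring
  have h1 := bavg_right (fun n => H (m - 1 - n)) (m - 1 - y) m K (by omega)
  rw [En_reflect] at h1
  simp only [bavg] at h1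
  have h2 : m - 1 - (m - 1 - y) = y := by omega
  rw [h2] at h1
  have h3 : ∑ a ∈ blk (m - 1 - y) K, H (m - 1 - a)
      = ∑ a ∈ Finset.Ico (y + 2 - 2 ^ (K + 1)) (y + 2 - 2 ^ K), H a := by
    refine Finset.sum_bij' (fun a _ => m - 1 - a) (fun a _ => m - 1 - a) ?_ ?_ ?_ ?_ ?_
    · intro a ha
      simp only [blk, Finset.mem_Ico] at ha ⊢
      omega
    · intro a ha
      simp only [blk, Finset.mem_Ico] at ha ⊢
      omega
    · intro a ha
      simp only [blk, Finset.mem_Ico] at ha ⊢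
      omega
    · intro a ha
      simp only [Finset.mem_Ico] at ha ⊢
      omega
    · intro a _
      rfl
  rw [h3] at h1
  exact h1

lemma resist_lt (H : ℕ → ℝ) (x y m : ℕ) (hxy : x < y) (hy : y < m) :
    (H x - H y) ^ 2 ≤ 120 * Real.log m * En m H := by
  obtain ⟨K, hK1, hK2⟩ : ∃ K, 2 ^ (K + 1) ≤ y - x + 2 ∧ y - x + 2 < 2 ^ (K + 2) := by
    have hne : y - x + 2 ≠ 0 := by omega
    have h1 := Nat.pow_log_le_self 2 hne
    have h2 := Nat.lt_pow_succ_log_self (b := 2) (by norm_num) (y - x + 2)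
    have h3 : 1 ≤ Nat.log 2 (y - x + 2) := Nat.log_pos (by norm_num) (by omega)
    refine ⟨Nat.log 2 (y - x + 2) - 1, ?_, ?_⟩
    · rwa [Nat.sub_add_cancel h3]
    · rwa [show Nat.log 2 (y - x + 2) - 1 + 2 = (Nat.log 2 (y - x + 2)).succ by omega]
  have hk := Nat.one_le_two_pow (n := K)
  have e1 : 2 ^ (K + 1) = 2 * 2 ^ K := by ring
  have e2 : 2 ^ (K + 2) = 4 * 2 ^ K := by ring
  have hR := bavg_right H x m K (by omega)
  have hL := bavg_left H y m K hy (by omega)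
  set T := Finset.Ico (y + 2 - 2 ^ (K + 1)) (y + 2 - 2 ^ K) with hT
  have hTc : (T.card : ℝ) = 2 ^ K := by
    have : T.card = 2 ^ K := by
      simp only [hT, Nat.card_Ico]; omega
    rw [this]; push_cast; rfl
  have hM : (bavg H x K - (∑ a ∈ T, H a) / 2 ^ K) ^ 2 ≤ 16 * En m H := by
    have h1 := block_le H (blk x K) T (2 ^ K) (2 ^ K) 16 (by positivity) (by positivity)
      (blk_card x K) hTc ?_
    swap
    · intro a ha b hb
      simp only [blk, hT, Finset.mem_Ico] at ha hb
      have hk' : (1 : ℝ) ≤ 2 ^ K := by exact_mod_cast hk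
      have h1 : (b : ℝ) + 1 ≤ a + 4 * 2 ^ K := by
        have : b + 1 ≤ a + 4 * 2 ^ K := by omega
        exact_mod_cast this
      have h2 : (a : ℝ) + 1 ≤ b + 4 * 2 ^ K := by
        have : a + 1 ≤ b + 4 * 2 ^ K := by omega
        exact_mod_cast this
      have h3 := wt_lower a b (4 * 2 ^ K - 1) (by linarith) (by linarith)
      refine h3.trans (mul_le_mul_of_nonneg_right ?_ (wt_nonneg a b))
      nlinarith
    refine h1.trans (mul_le_mul_of_nonneg_left ?_ (by norm_num))
    unfold En
    have hn : ∀ a b, 0 ≤ wt a b * (H a - H b) ^ 2 := fun a b =>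
      mul_nonneg (wt_nonneg a b) (sq_nonneg _)
    refine (Finset.sum_le_sum fun a _ => Finset.sum_le_sum_of_subset_of_nonneg
      (t := Finset.range m) ?_ fun b _ _ => hn a b).trans
      (Finset.sum_le_sum_of_subset_of_nonneg ?_
        fun a _ _ => Finset.sum_nonneg fun b _ => hn a b)
    · intro b hb
      simp only [hT, Finset.mem_Ico, Finset.mem_range] at hb ⊢
      omega
    · intro b hb
      simp only [blk, Finset.mem_Ico, Finset.mem_range] at hb ⊢
      omega
  have hlog : (K : ℝ) * Real.log 2 ≤ Real.log m := by
    rw [← Real.log_pow]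
    refine Real.log_le_log (by positivity) ?_
    have : 2 ^ K ≤ m := by omega
    exact_mod_cast this
  have hlog2 : Real.log 2 ≤ Real.log m :=
    Real.log_le_log (by norm_num) (by exact_mod_cast (by omega : 2 ≤ m))
  have hl := Real.log_two_gt_d9
  have hE := En_nonneg m H
  have h6 : (H x - H y) ^ 2 ≤ 3 * ((10 * K + 16) * En m H) := by
    set A := H x - bavg H x K
    set B := bavg H x K - (∑ a ∈ T, H a) / 2 ^ K
    set D := H y - (∑ a ∈ T, H a) / 2 ^ K
    have : H x - H y = A + B - D := by simp only [A, B, D]; ring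
    rw [this]
    nlinarith [sq_nonneg (A - B), sq_nonneg (A + D), sq_nonneg (B + D)]
  have h7 : 3 * (10 * (K : ℝ) + 16) ≤ 120 * Real.log m := by
    have hK0 : (0 : ℝ) ≤ K := by positivity
    have : (K : ℝ) * 0.69 ≤ Real.log m := by nlinarith
    nlinarith
  calc _ ≤ _ := h6
    _ = 3 * (10 * (K : ℝ) + 16) * En m H := by ring
    _ ≤ _ := mul_le_mul_of_nonneg_right h7 hE

lemma conduct_eq (m : ℕ) (x y : Fin m) : conduct m x y = wt x y := by
  simp [conduct, wt]

lemma resist (m : ℕ) (hm : 2 ≤ m) (h : Fin m → ℝ) (x y : Fin m) :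
    (h x - h y) ^ 2 ≤ 120 * Real.log m *
      ∑ a, ∑ b, conduct m a b * (h a - h b) ^ 2 := by
  set H : ℕ → ℝ := fun n => if hn : n < m then h ⟨n, hn⟩ else 0 with hH
  have hHx : ∀ a : Fin m, H a = h a := fun a => by simp [hH]
  have hE : ∑ a, ∑ b, conduct m a b * (h a - h b) ^ 2 = En m H := by
    unfold En
    rw [← Fin.sum_univ_eq_sum_range
      (fun a => ∑ b ∈ Finset.range m, wt a b * (H a - H b) ^ 2)]
    refine Finset.sum_congr rfl fun a _ => ?_
    rw [← Fin.sum_univ_eq_sum_range (fun b => wt a b * (H a - H b) ^ 2)]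
    refine Finset.sum_congr rfl fun b _ => ?_
    rw [conduct_eq, hHx, hHx]
  rw [hE]
  have hl : 0 ≤ Real.log m := Real.log_nonneg (by exact_mod_cast (by omega : 1 ≤ m))
  rcases lt_trichotomy x.val y.val with hlt | heq | hgt
  · have := resist_lt H x y m hlt y.2
    rwa [hHx, hHx] at this
  · have : x = y := Fin.ext heq
    subst this
    have := En_nonneg m H
    rw [sub_self, zero_pow two_ne_zero]
    exact mul_nonneg (mul_nonneg (by norm_num) hl) this
  · have := resist_lt H y x m hgt x.2
    rw [hHx, hHx] at this
    calc _ = (h y - h x) ^ 2 := by ring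
      _ ≤ _ := this

lemma sum_inv_le (n : ℕ) : ∑ d ∈ Finset.range (n + 1), 1 / (1 + (d : ℝ) ^ 2) ≤
    (3 : ℝ) - 2 / ((n : ℝ) + 1) := by
  induction n with
  | zero => norm_num
  | succ n ih =>
    rw [Finset.sum_range_succ]
    have : 1 / (1 + ((n + 1 : ℕ) : ℝ) ^ 2) ≤ 2 / ((n : ℝ) + 1) - 2 / ((n : ℝ) + 2) := by
      rw [div_sub_div _ _ (by positivity) (by positivity), div_le_div_iff₀ (by positivity) (by positivity)]
      push_cast
      nlinarith
    push_cast at this ih ⊢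
    rw [show (n : ℝ) + 1 + 1 = n + 2 by ring]
    linarith

lemma sum_inv_le' (n : ℕ) : ∑ d ∈ Finset.range n, 1 / (1 + (d : ℝ) ^ 2) ≤ 3 := by
  have h := sum_inv_le n
  rw [Finset.sum_range_succ] at h
  have h1 : 0 ≤ 1 / (1 + (n : ℝ) ^ 2) := by positivity
  have h2 : 0 ≤ 2 / ((n : ℝ) + 1) := by positivity
  linarith

lemma conduct_row (m : ℕ) (x : Fin m) : ∑ y, conduct m x y ≤ 6 := by
  simp only [conduct_eq]
  rw [Fin.sum_univ_eq_sum_range (fun b => wt x b), Finset.range_eq_Ico,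
    ← Finset.sum_Ico_consecutive _ (Nat.zero_le x.val) x.2.le, ← Finset.range_eq_Ico]
  have h1 : ∑ i ∈ Finset.range x, wt x i ≤ 3 := by
    rw [← Finset.sum_range_reflect]
    refine le_trans (Finset.sum_le_sum fun d hd => ?_) (sum_inv_le' x)
    rw [Finset.mem_range] at hd
    have ea : ((x.val - 1 - d : ℕ) : ℝ) = (x.val : ℝ) - 1 - d := by
      rw [Nat.cast_sub (by omega), Nat.cast_sub (by omega)]; simp
    unfold wt
    rw [ea]
    refine one_div_le_one_div_of_le (by positivity) ?_
    have : (0 : ℝ) ≤ d := by positivity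
    nlinarith
  have h2 : ∑ i ∈ Finset.Ico x.val m, wt x i ≤ 3 := by
    rw [Finset.sum_Ico_eq_sum_range]
    refine le_trans (le_of_eq (Finset.sum_congr rfl fun d _ => ?_)) (sum_inv_le' (m - x))
    unfold wt
    push_cast
    congr 2
    ring
  linarith

lemma conduct_pos (m : ℕ) (x y : Fin m) : 0 < conduct m x y := by
  rw [conduct_eq]; unfold wt; positivity

lemma row_pos (m : ℕ) (x : Fin m) : 0 < ∑ y, conduct m x y :=
  Finset.sum_pos (fun y _ => conduct_pos m x y) ⟨x, Finset.mem_univ _⟩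

/-- total conductance -/
def Tot (m : ℕ) : ℝ := ∑ z, ∑ z', conduct m z z'

lemma Tot_le (m : ℕ) : Tot m ≤ 6 * m := by
  unfold Tot
  refine (Finset.sum_le_sum fun x _ => conduct_row m x).trans ?_
  simp [mul_comm]

lemma Tot_pos (m : ℕ) (hm : 2 ≤ m) : 0 < Tot m :=
  Finset.sum_pos (fun x _ => row_pos m x) ⟨⟨0, by omega⟩, Finset.mem_univ _⟩

/-! ### Part B: Walsh expansion -/

/-- the character of `{0,1}` -/
def bsgn (a s : Bool) : ℝ := if a && s then -1 else 1

/-- Walsh functions -/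
def walsh {m : ℕ} (A σ : Fin m → Bool) : ℝ := ∏ i, bsgn (A i) (σ i)

lemma walsh_orth {m : ℕ} (σ τ : Fin m → Bool) :
    ∑ A : Fin m → Bool, walsh A σ * walsh A τ = if σ = τ then (2 : ℝ) ^ m else 0 := by
  simp only [walsh, ← Finset.prod_mul_distrib]
  have h := Finset.prod_univ_sum (fun _ : Fin m => (Finset.univ : Finset Bool))
    (fun i b => bsgn b (σ i) * bsgn b (τ i))
  rw [Fintype.piFinset_univ] at h
  rw [← h]
  have h2 : ∀ i, ∑ b : Bool, bsgn b (σ i) * bsgn b (τ i) = if σ i = τ i then (2 : ℝ) else 0 := by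
    intro i
    rw [Fintype.sum_bool]
    cases σ i <;> cases τ i <;> norm_num [bsgn]
  simp only [h2]
  split_ifs with hst
  · subst hst; simp
  · obtain ⟨i, hi⟩ := Function.ne_iff.mp hst
    exact Finset.prod_eq_zero (Finset.mem_univ i) (by simp [hi])

/-- Walsh transform -/
def what {m : ℕ} (g : (Fin m → Bool) → ℝ) (A : Fin m → Bool) : ℝ := ∑ σ, g σ * walsh A σ

lemma parseval {m : ℕ} (g : (Fin m → Bool) → ℝ) :
    ∑ A, what g A ^ 2 = 2 ^ m * ∑ σ, g σ ^ 2 := by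
  have h1 : ∀ A, what g A ^ 2 = ∑ σ, ∑ τ, g σ * g τ * (walsh A σ * walsh A τ) := by
    intro A
    rw [sq, what, Finset.sum_mul_sum]
    refine Finset.sum_congr rfl fun σ _ => Finset.sum_congr rfl fun τ _ => by ring
  simp only [h1]
  rw [Finset.sum_comm]
  rw [Finset.mul_sum]
  refine Finset.sum_congr rfl fun σ _ => ?_
  rw [Finset.sum_comm]
  simp only [← Finset.mul_sum, walsh_orth]
  simp
  ring

/-- flip the lamp at `a` -/
def lflip {m : ℕ} (a : Fin m) (σ : Fin m → Bool) : Fin m → Bool := Function.update σ a (!σ a)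

lemma lflip_invol {m : ℕ} (a : Fin m) : Function.Involutive (lflip a) := by
  intro σ
  ext i
  by_cases h : i = a
  · subst h; simp [lflip]
  · simp [lflip, h]

lemma walsh_flip {m : ℕ} (a : Fin m) (A σ : Fin m → Bool) (hA : A a = true) :
    walsh A (lflip a σ) = - walsh A σ := by
  unfold walsh
  rw [← Finset.mul_prod_erase _ _ (Finset.mem_univ a),
    ← Finset.mul_prod_erase _ (fun i => bsgn (A i) (σ i)) (Finset.mem_univ a), ← neg_mul]
  congr 1
  · simp only [lflip, Function.update_self, hA]
    cases σ a <;> simp [bsgn]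
  · refine Finset.prod_congr rfl fun i hi => ?_
    rw [lflip, Function.update_of_ne (Finset.ne_of_mem_erase hi)]

lemma what_flip {m : ℕ} (a : Fin m) (A : Fin m → Bool) (g : (Fin m → Bool) → ℝ)
    (hA : A a = true) : what (fun σ => g σ - g (lflip a σ)) A = 2 * what g A := by
  unfold what
  have h1 : ∑ σ, g (lflip a σ) * walsh A σ = - ∑ σ, g σ * walsh A σ := by
    rw [← Equiv.sum_comp (lflip_invol a).toPerm (fun σ => g (lflip a σ) * walsh A σ),
      ← Finset.sum_neg_distrib]
    refine Finset.sum_congr rfl fun σ _ => ?_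
    simp only [Function.Involutive.coe_toPerm]
    rw [lflip_invol a σ, walsh_flip a A σ hA]
    ring
  simp only [sub_mul, Finset.sum_sub_distrib]
  rw [h1]
  ring

lemma what_sub {m : ℕ} (g h : (Fin m → Bool) → ℝ) (A : Fin m → Bool) :
    what (fun σ => g σ - h σ) A = what g A - what h A := by
  simp [what, sub_mul]

lemma wflip_sum {m : ℕ} (a : Fin m) (g : (Fin m → Bool) → ℝ) :
    ∑ A : Fin m → Bool, (if A a = true then what g A ^ 2 else 0) ≤
      1 / 4 * (2 ^ m * ∑ σ, (g σ - g (lflip a σ)) ^ 2) := by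
  rw [← parseval (fun σ => g σ - g (lflip a σ)), Finset.mul_sum]
  refine Finset.sum_le_sum fun A _ => ?_
  split_ifs with h
  · rw [what_flip a A g h]
    apply le_of_eq; ring
  · positivity

/-- the zero character -/
def zch (m : ℕ) : Fin m → Bool := fun _ => false

lemma pair_sum {m : ℕ} (g h : (Fin m → Bool) → ℝ) :
    ∑ σ, ∑ τ, (g σ - h τ) ^ 2 = (what g (zch m) - what h (zch m)) ^ 2 +
      ∑ A ∈ Finset.univ.erase (zch m), (what g A ^ 2 + what h A ^ 2) := by
  have hz : ∀ g : (Fin m → Bool) → ℝ, what g (zch m) = ∑ σ, g σ := by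
    intro g; simp [what, walsh, bsgn, zch]
  have h1 : ∑ σ, ∑ τ, (g σ - h τ) ^ 2 =
      2 ^ m * ∑ σ, g σ ^ 2 + 2 ^ m * ∑ σ, h σ ^ 2 - 2 * ((∑ σ, g σ) * ∑ σ, h σ) := by
    rw [Finset.sum_mul_sum]
    simp only [sub_sq, Finset.sum_add_distrib, Finset.sum_sub_distrib, Finset.sum_const,
      Finset.card_univ, Fintype.card_fun, Fintype.card_bool, Fintype.card_fin, nsmul_eq_mul,
      Finset.mul_sum, mul_assoc]
    push_cast
    ring
  rw [h1, ← parseval, ← parseval, ← hz g, ← hz h,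
    ← Finset.add_sum_erase _ (fun A => what g A ^ 2) (Finset.mem_univ (zch m)),
    ← Finset.add_sum_erase _ (fun A => what h A ^ 2) (Finset.mem_univ (zch m)),
    Finset.sum_add_distrib]
  ring

/-- lamp part of the energy -/
def Pen {m : ℕ} (f : Lamp m → ℝ) : ℝ := ∑ a, ∑ σ, (f (σ, a) - f (lflip a σ, a)) ^ 2

/-- moving part of the energy -/
def Qen {m : ℕ} (f : Lamp m → ℝ) : ℝ :=
  ∑ a, ∑ b, conduct m a b * ∑ σ, (f (σ, a) - f (σ, b)) ^ 2

lemma fiber_bound (m : ℕ) (hm : 2 ≤ m) (f : Lamp m → ℝ) (x y : Fin m) :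
    ∑ σ, ∑ τ, (f (σ, x) - f (τ, y)) ^ 2 ≤
      2 ^ m * (Pen f + 480 * Real.log m * Qen f) := by
  set h : (Fin m → Bool) → Fin m → ℝ := fun A x => what (fun σ => f (σ, x)) A with hh
  set En : (Fin m → Bool) → ℝ :=
    fun A => ∑ a, ∑ b, conduct m a b * (h A a - h A b) ^ 2 with hEn
  set Lp : (Fin m → Bool) → ℝ := fun A => ∑ a, (if A a = true then h A a ^ 2 else 0) with hLp
  have hl : 0 ≤ Real.log m := Real.log_nonneg (by exact_mod_cast (by omega : 1 ≤ m))
  have hEn0 : ∀ A, 0 ≤ En A := fun A => Finset.sum_nonneg fun a _ =>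
    Finset.sum_nonneg fun b _ => mul_nonneg (conduct_pos m a b).le (sq_nonneg _)
  have hLp0 : ∀ A, 0 ≤ Lp A := fun A => Finset.sum_nonneg fun a _ => by
    split_ifs <;> positivity
  have hsumE : ∑ A, En A = 2 ^ m * Qen f := by
    simp only [hEn, Qen]
    rw [Finset.sum_comm, Finset.mul_sum]
    refine Finset.sum_congr rfl fun a _ => ?_
    rw [Finset.sum_comm, Finset.mul_sum]
    refine Finset.sum_congr rfl fun b _ => ?_
    rw [← Finset.mul_sum]
    have := parseval (fun σ => f (σ, a) - f (σ, b))
    simp only [what_sub] at this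
    simp only [hh]
    rw [this]
    ring
  have hsumL : ∑ A, Lp A ≤ 1 / 4 * (2 ^ m * Pen f) := by
    simp only [hLp, Pen]
    rw [Finset.sum_comm, Finset.mul_sum, Finset.mul_sum]
    refine Finset.sum_le_sum fun a _ => ?_
    exact wflip_sum a (fun σ => f (σ, a))
  have hpt : ∀ A ∈ Finset.univ.erase (zch m), ∀ x, h A x ^ 2 ≤
      2 * Lp A + 240 * Real.log m * En A := by
    intro A hA x
    obtain ⟨a, ha⟩ := Function.ne_iff.mp (Finset.ne_of_mem_erase hA)
    have ha' : A a = true := by simpa [zch] using ha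
    have h1 := resist m hm (h A) x a
    have h2 : h A a ^ 2 ≤ Lp A := by
      have := Finset.single_le_sum (f := fun a => (if A a = true then h A a ^ 2 else 0))
        (fun i _ => by split_ifs <;> positivity) (Finset.mem_univ a)
      simpa [ha'] using this
    have h3 : (h A x - h A a) ^ 2 ≤ 120 * Real.log m * En A := h1
    nlinarith [sq_nonneg (h A x - 2 * h A a)]
  have hz : (h (zch m) x - h (zch m) y) ^ 2 ≤ 4 * Lp (zch m) + 480 * Real.log m * En (zch m) := by
    have h1 : (h (zch m) x - h (zch m) y) ^ 2 ≤ 120 * Real.log m * En (zch m) :=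
      resist m hm (h (zch m)) x y
    have h2 := hLp0 (zch m)
    have h3 := mul_nonneg hl (hEn0 (zch m))
    linarith
  have h4 := pair_sum (fun σ => f (σ, x)) (fun σ => f (σ, y))
  rw [h4]
  have h5 : (h (zch m) x - h (zch m) y) ^ 2 +
      ∑ A ∈ Finset.univ.erase (zch m), (h A x ^ 2 + h A y ^ 2) ≤
      ∑ A, (4 * Lp A + 480 * Real.log m * En A) := by
    rw [← Finset.add_sum_erase _ (fun A => 4 * Lp A + 480 * Real.log m * En A)
      (Finset.mem_univ (zch m))]
    refine add_le_add hz (Finset.sum_le_sum fun A hA => ?_)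
    have := hpt A hA x
    have := hpt A hA y
    linarith
  refine h5.trans ?_
  rw [Finset.sum_add_distrib, ← Finset.mul_sum, ← Finset.mul_sum, hsumE]
  nlinarith

/-! ### Part C: the lamplighter kernel and the quadratic Poincaré inequality -/

lemma statBase_nonneg (m : ℕ) (hm : 2 ≤ m) (x : Fin m) : 0 ≤ statBase m x :=
  div_nonneg (row_pos m x).le (Tot_pos m hm).le

lemma statBase_sum (m : ℕ) (hm : 2 ≤ m) : ∑ x, statBase m x = 1 := by
  unfold statBase
  rw [← Finset.sum_div]
  exact div_self (Tot_pos m hm).ne'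

lemma Um_nonneg (m : ℕ) (hm : 2 ≤ m) (u : Lamp m) : 0 ≤ Um m u :=
  mul_nonneg (by positivity) (statBase_nonneg m hm u.2)

lemma Um_sum (m : ℕ) (hm : 2 ≤ m) : ∑ u, Um m u = 1 := by
  rw [Fintype.sum_prod_type]
  simp only [Um, ← Finset.mul_sum, statBase_sum m hm]
  simp

lemma zeta_pos (m : ℕ) (x y : Fin m) : 0 < zeta m x y :=
  div_pos (conduct_pos m x y) (row_pos m x)

lemma zeta_sum (m : ℕ) (x : Fin m) : ∑ y, zeta m x y = 1 := by
  unfold zeta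
  rw [← Finset.sum_div]
  exact div_self (row_pos m x).ne'

lemma stat_zeta (m : ℕ) (x y : Fin m) :
    statBase m x * zeta m x y = conduct m x y / Tot m := by
  have := (row_pos m x).ne'
  unfold statBase zeta Tot
  field_simp

lemma conduct_symm (m : ℕ) (x y : Fin m) : conduct m x y = conduct m y x := by
  rw [conduct_eq, conduct_eq, wt, wt]; congr 2; ring

lemma pker_nonneg (m : ℕ) (u v : Lamp m) : 0 ≤ pker m u v := by
  unfold pker
  have h1 := (zeta_pos m u.2 v.2).le
  have h2 := (zeta_pos m u.2 u.2).le
  split_ifs <;> linarith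

lemma rev_pker (m : ℕ) (u v : Lamp m) : Um m u * pker m u v = Um m v * pker m v u := by
  obtain ⟨σ, x⟩ := u
  obtain ⟨τ, y⟩ := v
  have h1 := stat_zeta m x y
  have h2 := stat_zeta m y x
  rw [conduct_symm m y x, ← h1] at h2
  by_cases hxy : x = y
  · subst hxy
    unfold pker Um
    simp only [ne_eq, not_true_eq_false, false_and, if_false, true_and]
    have : (∀ z, ¬ z = x → σ z = τ z) ↔ (∀ z, ¬ z = x → τ z = σ z) :=
      ⟨fun h z hz => (h z hz).symm, fun h z hz => (h z hz).symm⟩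
    simp only [this]
  · have hyx : ¬ y = x := fun h => hxy h.symm
    unfold pker Um
    simp only [ne_eq, hxy, hyx, not_false_eq_true, true_and, false_and, if_false]
    have : (∀ z, ¬ z = x → ¬ z = y → σ z = τ z) ↔ (∀ z, ¬ z = y → ¬ z = x → τ z = σ z) :=
      ⟨fun h z hz hz' => (h z hz' hz).symm, fun h z hz hz' => (h z hz' hz).symm⟩
    simp only [this]
    split_ifs
    · linear_combination (-(1 / 2 : ℝ) ^ m * (1 / 4)) * h2
    · ring

open Classical in
lemma pker_row (m : ℕ) (u : Lamp m) : ∑ v, pker m u v ≤ 1 := by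
  obtain ⟨σ, x⟩ := u
  rw [Fintype.sum_prod_type_right, ← zeta_sum m x]
  refine Finset.sum_le_sum fun y _ => ?_
  have hz := (zeta_pos m x y).le
  by_cases hxy : x = y
  · subst hxy
    unfold pker
    simp only [ne_eq, not_true_eq_false, false_and, if_false, true_and]
    rw [← Finset.sum_filter, Finset.sum_const, nsmul_eq_mul]
    have hc : (Finset.univ.filter fun τ : Fin m → Bool => ∀ z, ¬ z = x → σ z = τ z).card ≤ 2 := by
      have := Finset.card_le_card_of_injOn (t := (Finset.univ : Finset Bool))
        (s := Finset.univ.filter fun τ : Fin m → Bool => ∀ z, ¬ z = x → σ z = τ z)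
        (fun τ => τ x) (fun _ _ => Finset.mem_univ _) ?_
      · simpa using this
      · intro τ hτ τ' hτ' h
        simp only [Finset.coe_filter, Finset.mem_univ, true_and, Set.mem_ofPred_eq] at hτ hτ'
        funext z
        by_cases hz : z = x
        · subst hz; exact h
        · rw [← hτ z hz, ← hτ' z hz]
    have hc' : ((Finset.univ.filter fun τ : Fin m → Bool => ∀ z, ¬ z = x → σ z = τ z).card : ℝ) ≤ 2 := by
      exact_mod_cast hc
    nlinarith
  · unfold pker
    simp only [ne_eq, hxy, not_false_eq_true, true_and, false_and, if_false]
    rw [← Finset.sum_filter, Finset.sum_const, nsmul_eq_mul]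
    have hc : (Finset.univ.filter fun τ : Fin m → Bool =>
        ∀ z, ¬ z = x → ¬ z = y → σ z = τ z).card ≤ 4 := by
      have := Finset.card_le_card_of_injOn (t := (Finset.univ : Finset (Bool × Bool)))
        (s := Finset.univ.filter fun τ : Fin m → Bool => ∀ z, ¬ z = x → ¬ z = y → σ z = τ z)
        (fun τ => (τ x, τ y)) (fun _ _ => Finset.mem_univ _) ?_
      · simpa using this
      · intro τ hτ τ' hτ' h
        simp only [Finset.coe_filter, Finset.mem_univ, true_and, Set.mem_ofPred_eq] at hτ hτ'
        simp only [Prod.mk.injEq] at h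
        funext z
        by_cases hz : z = x
        · subst hz; exact h.1
        · by_cases hz' : z = y
          · subst hz'; exact h.2
          · rw [← hτ z hz hz', ← hτ' z hz hz']
    have hc' : ((Finset.univ.filter fun τ : Fin m → Bool =>
        ∀ z, ¬ z = x → ¬ z = y → σ z = τ z).card : ℝ) ≤ 4 := by
      exact_mod_cast hc
    nlinarith

lemma lhs_bound (m : ℕ) (hm : 2 ≤ m) (f : Lamp m → ℝ) :
    ∑ u, ∑ v, (f u - f v) ^ 2 * Um m u * Um m v ≤
      (1 / 2) ^ m * (Pen f + 480 * Real.log m * Qen f) := by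
  have h1 : ∑ u, ∑ v, (f u - f v) ^ 2 * Um m u * Um m v =
      ∑ x, ∑ y, ((1 / 2) ^ m * (1 / 2) ^ m * (statBase m x * statBase m y)) *
        ∑ σ, ∑ τ, (f (σ, x) - f (τ, y)) ^ 2 := by
    rw [Fintype.sum_prod_type_right]
    refine Finset.sum_congr rfl fun x _ => ?_
    simp only [Fintype.sum_prod_type_right]
    rw [Finset.sum_comm]
    refine Finset.sum_congr rfl fun y _ => ?_
    rw [Finset.mul_sum]
    refine Finset.sum_congr rfl fun σ _ => ?_
    rw [Finset.mul_sum]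
    refine Finset.sum_congr rfl fun τ _ => ?_
    simp only [Um]
    ring
  rw [h1]
  set B := Pen f + 480 * Real.log m * Qen f
  have h2 : ∀ x y, ((1 / 2 : ℝ) ^ m * (1 / 2) ^ m * (statBase m x * statBase m y)) *
        ∑ σ, ∑ τ, (f (σ, x) - f (τ, y)) ^ 2 ≤ (statBase m x * statBase m y) * ((1 / 2) ^ m * B) := by
    intro x y
    have h3 := fiber_bound m hm f x y
    have h4 := mul_nonneg (statBase_nonneg m hm x) (statBase_nonneg m hm y)
    refine (mul_le_mul_of_nonneg_left h3 (by positivity)).trans (le_of_eq ?_)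
    have : ((1 / 2 : ℝ) ^ m) * 2 ^ m = 1 := by rw [← mul_pow]; norm_num
    linear_combination ((1 / 2 : ℝ) ^ m * statBase m x * statBase m y * B) * this
  refine (Finset.sum_le_sum fun x _ => Finset.sum_le_sum fun y _ => h2 x y).trans (le_of_eq ?_)
  simp only [← Finset.sum_mul, ← Finset.mul_sum, statBase_sum m hm]
  ring

lemma rhs_bound (m : ℕ) (hm : 2 ≤ m) (f : Lamp m → ℝ) :
    (1 / 2) ^ m / Tot m * (1 / 2 * Pen f + 1 / 4 * Qen f) ≤
      ∑ u, ∑ v, (f u - f v) ^ 2 * Um m u * pker m u v := by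
  have hT := Tot_pos m hm
  have key : ∀ (σ : Fin m → Bool) (x y : Fin m),
      (1 / 2) ^ m / Tot m * ((if x = y then 1 / 2 * (f (σ, x) - f (lflip x σ, x)) ^ 2 else 0) +
        1 / 4 * (conduct m x y * (f (σ, x) - f (σ, y)) ^ 2)) ≤
      ∑ τ, (f (σ, x) - f (τ, y)) ^ 2 * Um m (σ, x) * pker m (σ, x) (τ, y) := by
    intro σ x y
    have hnn : ∀ τ ∈ Finset.univ,
        0 ≤ (f (σ, x) - f (τ, y)) ^ 2 * Um m (σ, x) * pker m (σ, x) (τ, y) := fun τ _ =>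
      mul_nonneg (mul_nonneg (sq_nonneg _) (Um_nonneg m hm _)) (pker_nonneg m _ _)
    by_cases hxy : x = y
    · subst hxy
      refine le_trans (le_of_eq ?_) (Finset.single_le_sum hnn (Finset.mem_univ (lflip x σ)))
      have h1 := stat_zeta m x x
      have hc : conduct m x x = 1 := by simp [conduct]
      rw [hc] at h1
      have hp : pker m (σ, x) (lflip x σ, x) = 1 / 2 * zeta m x x := by
        unfold pker
        simp only [ne_eq, not_true_eq_false, false_and, if_false, true_and]
        rw [if_pos]
        intro z hz
        rw [lflip, Function.update_of_ne hz]
      rw [hp, if_pos rfl]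
      simp only [Um]
      linear_combination (-(1 / 2 : ℝ) ^ m * (1 / 2) * (f (σ, x) - f (lflip x σ, x)) ^ 2) * h1
    · refine le_trans (le_of_eq ?_) (Finset.single_le_sum hnn (Finset.mem_univ σ))
      have h1 := stat_zeta m x y
      have hp : pker m (σ, x) (σ, y) = 1 / 4 * zeta m x y := by
        unfold pker
        simp [hxy]
      rw [hp, if_neg hxy]
      simp only [Um]
      linear_combination (-(1 / 2 : ℝ) ^ m * (1 / 4) * (f (σ, x) - f (σ, y)) ^ 2) * h1
  have h2 : (1 / 2) ^ m / Tot m * (1 / 2 * Pen f + 1 / 4 * Qen f) =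
      ∑ x, ∑ σ, ∑ y, (1 / 2) ^ m / Tot m *
        ((if x = y then 1 / 2 * (f (σ, x) - f (lflip x σ, x)) ^ 2 else 0) +
        1 / 4 * (conduct m x y * (f (σ, x) - f (σ, y)) ^ 2)) := by
    simp only [← Finset.mul_sum, Finset.sum_add_distrib, Finset.sum_ite_eq, Finset.mem_univ,
      if_true, Pen, Qen]
    congr 3
    refine Finset.sum_congr rfl fun x _ => ?_
    rw [Finset.sum_comm]
    refine Finset.sum_congr rfl fun y _ => ?_
    rw [Finset.mul_sum]
  rw [h2, Fintype.sum_prod_type_right]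
  refine Finset.sum_le_sum fun x _ => Finset.sum_le_sum fun σ _ => ?_
  rw [Fintype.sum_prod_type_right]
  exact Finset.sum_le_sum fun y _ => key σ x y

lemma poincare_two (m : ℕ) (hm : 2 ≤ m) (f : Lamp m → ℝ) :
    ∑ u, ∑ v, (f u - f v) ^ 2 * Um m u * Um m v ≤
      12000 * m * Real.log m * ∑ u, ∑ v, (f u - f v) ^ 2 * Um m u * pker m u v := by
  have hT := Tot_pos m hm
  have hT6 := Tot_le m
  have hP : 0 ≤ Pen f := Finset.sum_nonneg fun _ _ => Finset.sum_nonneg fun _ _ => sq_nonneg _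
  have hQ : 0 ≤ Qen f := Finset.sum_nonneg fun a _ => Finset.sum_nonneg fun b _ =>
    mul_nonneg (conduct_pos m a b).le (Finset.sum_nonneg fun _ _ => sq_nonneg _)
  have hlog2 : Real.log 2 ≤ Real.log m :=
    Real.log_le_log (by norm_num) (by exact_mod_cast hm)
  have hl2 := Real.log_two_gt_d9
  have hl : 0 ≤ Real.log m := by linarith
  refine (lhs_bound m hm f).trans (le_trans ?_
    (mul_le_mul_of_nonneg_left (rhs_bound m hm f) (by positivity)))
  have e : 12000 * m * Real.log m * ((1 / 2) ^ m / Tot m * (1 / 2 * Pen f + 1 / 4 * Qen f)) =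
    (1 / 2) ^ m * ((m / Tot m) * (Real.log m * (6000 * Pen f + 3000 * Qen f))) := by
    field_simp
    ring
  rw [e]
  refine mul_le_mul_of_nonneg_left ?_ (by positivity)
  have h6 : 1 / 6 ≤ (m : ℝ) / Tot m := by
    rw [div_le_div_iff₀ (by norm_num) hT]; linarith
  have h7 : 0 ≤ Real.log m * (6000 * Pen f + 3000 * Qen f) := by positivity
  have h8 := mul_le_mul_of_nonneg_right h6 h7
  have h9 : 0 ≤ (Real.log m - 0.69) * Pen f := mul_nonneg (by linarith) hP
  have h10 : 0 ≤ Real.log m * Qen f := mul_nonneg hl hQ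
  nlinarith

/-! ### Part D: from exponent two to exponents below two -/

/-- kernel of the integral representation of `|a|^p` -/
def jker (p a s : ℝ) : ℝ := (1 - Real.cos (a * s)) * s ^ (-1 - p)

lemma one_sub_cos_nonneg (x : ℝ) : 0 ≤ 1 - Real.cos x := by
  have := Real.cos_le_one x; linarith

lemma jker_integrable (p a : ℝ) (hp0 : 0 < p) (hp2 : p < 2) :
    MeasureTheory.IntegrableOn (jker p a) (Set.Ioi 0) := by
  have hmeas : ∀ S : Set ℝ, MeasureTheory.AEStronglyMeasurable (jker p a)
      (MeasureTheory.volume.restrict S) := by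
    intro S
    apply Measurable.aestronglyMeasurable
    unfold jker
    fun_prop
  rw [← Set.Ioc_union_Ioi_eq_Ioi (zero_le_one' ℝ)]
  refine MeasureTheory.IntegrableOn.union ?_ ?_
  · have h1 : MeasureTheory.IntegrableOn (fun s : ℝ => a ^ 2 / 2 * s ^ (1 - p)) (Set.Ioc 0 1) := by
      have := (intervalIntegral.intervalIntegrable_rpow' (a := 0) (b := 1)
        (r := 1 - p) (by linarith)).1
      exact this.const_mul _
    refine MeasureTheory.Integrable.mono' h1 (hmeas _) ?_
    rw [MeasureTheory.ae_restrict_iff' measurableSet_Ioc]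
    refine Filter.Eventually.of_forall fun s hs => ?_
    have hs0 : 0 < s := hs.1
    rw [jker, Real.norm_of_nonneg (mul_nonneg (one_sub_cos_nonneg _) (Real.rpow_nonneg hs0.le _))]
    have e : s ^ (1 - p) = s ^ 2 * s ^ (-1 - p) := by
      rw [← Real.rpow_natCast s 2, ← Real.rpow_add hs0]; congr 1; push_cast; ring
    rw [e, ← mul_assoc]
    refine mul_le_mul_of_nonneg_right ?_ (Real.rpow_nonneg hs0.le _)
    have := Real.one_sub_sq_div_two_le_cos (x := a * s)
    nlinarith
  · have h1 : MeasureTheory.IntegrableOn (fun s : ℝ => 2 * s ^ (-1 - p)) (Set.Ioi 1) :=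
      (integrableOn_Ioi_rpow_of_lt (by linarith) one_pos).const_mul _
    refine MeasureTheory.Integrable.mono' h1 (hmeas _) ?_
    rw [MeasureTheory.ae_restrict_iff' measurableSet_Ioi]
    refine Filter.Eventually.of_forall fun s hs => ?_
    have hs0 : 0 < s := lt_trans one_pos hs
    rw [jker, Real.norm_of_nonneg (mul_nonneg (one_sub_cos_nonneg _) (Real.rpow_nonneg hs0.le _))]
    refine mul_le_mul_of_nonneg_right ?_ (Real.rpow_nonneg hs0.le _)
    have := Real.neg_one_le_cos (a * s)
    linarith

lemma jker_pos (p : ℝ) (hp0 : 0 < p) (hp2 : p < 2) :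
    0 < ∫ s in Set.Ioi 0, jker p 1 s := by
  rw [MeasureTheory.setIntegral_pos_iff_support_of_nonneg_ae _ (jker_integrable p 1 hp0 hp2)]
  · have hsub : Set.Ioo (0 : ℝ) 1 ⊆ Function.support (jker p 1) ∩ Set.Ioi 0 := by
      intro s hs
      refine ⟨?_, hs.1⟩
      rw [Function.mem_support]
      unfold jker
      have h1 : Real.cos (1 * s) < 1 := by
        rw [one_mul, ← Real.cos_zero]
        exact Real.cos_lt_cos_of_nonneg_of_le_pi le_rfl
          (by have := Real.pi_gt_three; linarith [hs.2]) hs.1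
      have h2 := Real.rpow_pos_of_pos hs.1 (-1 - p)
      exact (mul_pos (by linarith) h2).ne'
    refine lt_of_lt_of_le ?_ (MeasureTheory.measure_mono hsub)
    simp
  · rw [Filter.EventuallyLE, MeasureTheory.ae_restrict_iff' measurableSet_Ioi]
    exact Filter.Eventually.of_forall fun s hs =>
      mul_nonneg (one_sub_cos_nonneg _) (Real.rpow_nonneg (le_of_lt hs) _)

lemma jker_scale (p a : ℝ) (hp0 : 0 < p) :
    ∫ s in Set.Ioi 0, jker p a s = |a| ^ p * ∫ s in Set.Ioi 0, jker p 1 s := by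
  by_cases ha : a = 0
  · subst ha
    simp [jker, Real.zero_rpow hp0.ne']
  have hb : 0 < |a| := abs_pos.mpr ha
  have h1 := MeasureTheory.integral_comp_mul_left_Ioi (jker p 1) 0 hb
  rw [mul_zero, smul_eq_mul] at h1
  have h2 : ∫ s in Set.Ioi 0, jker p a s =
      ∫ s in Set.Ioi 0, |a| ^ (1 + p) * jker p 1 (|a| * s) := by
    refine MeasureTheory.setIntegral_congr_fun measurableSet_Ioi fun s hs => ?_
    have hs0 : (0 : ℝ) < s := hs
    have e1 : Real.cos (a * s) = Real.cos (1 * (|a| * s)) := by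
      rw [one_mul, ← Real.cos_abs (a * s), abs_mul, abs_of_pos hs0]
    have e2 : |a| ^ (1 + p) * |a| ^ (-1 - p) = 1 := by
      rw [← Real.rpow_add hb, show 1 + p + (-1 - p) = 0 by ring, Real.rpow_zero]
    simp only [jker]
    rw [e1, Real.mul_rpow hb.le hs0.le]
    linear_combination (-(1 - Real.cos (1 * (|a| * s))) * s ^ (-1 - p)) * e2
  rw [h2, MeasureTheory.integral_const_mul, h1, ← mul_assoc]
  congr 1
  rw [Real.rpow_add hb, Real.rpow_one]
  field_simp

lemma extrap_lt {V : Type*} [Fintype V] (A B : V → V → ℝ)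
    (h2 : ∀ f : V → ℝ, ∑ u, ∑ v, (f u - f v) ^ 2 * A u v ≤ ∑ u, ∑ v, (f u - f v) ^ 2 * B u v)
    (p : ℝ) (hp0 : 0 < p) (hp2 : p < 2) (f : V → ℝ) :
    ∑ u, ∑ v, |f u - f v| ^ p * A u v ≤ ∑ u, ∑ v, |f u - f v| ^ p * B u v := by
  have hJ := jker_pos p hp0 hp2
  set J := ∫ s in Set.Ioi 0, jker p 1 s with hJdef
  have hrep : ∀ A : V → V → ℝ, (∑ u, ∑ v, |f u - f v| ^ p * A u v) * J =
      ∫ s in Set.Ioi 0, ∑ u, ∑ v, jker p (f u - f v) s * A u v := by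
    intro A
    rw [MeasureTheory.integral_finsetSum]
    swap
    · intro u _
      exact MeasureTheory.integrable_finsetSum _ fun v _ =>
        (jker_integrable p _ hp0 hp2).mul_const _
    rw [Finset.sum_mul]
    refine Finset.sum_congr rfl fun u _ => ?_
    rw [MeasureTheory.integral_finsetSum]
    swap
    · intro v _
      exact (jker_integrable p _ hp0 hp2).mul_const _
    rw [Finset.sum_mul]
    refine Finset.sum_congr rfl fun v _ => ?_
    rw [MeasureTheory.integral_mul_const, jker_scale p _ hp0]
    ring
  have hIntg : ∀ A : V → V → ℝ, MeasureTheory.IntegrableOn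
      (fun s => ∑ u, ∑ v, jker p (f u - f v) s * A u v) (Set.Ioi 0) := by
    intro A
    exact MeasureTheory.integrable_finsetSum _ fun u _ =>
      MeasureTheory.integrable_finsetSum _ fun v _ =>
        (jker_integrable p _ hp0 hp2).mul_const _
  have hmain : (∑ u, ∑ v, |f u - f v| ^ p * A u v) * J ≤
      (∑ u, ∑ v, |f u - f v| ^ p * B u v) * J := by
    rw [hrep, hrep]
    refine MeasureTheory.setIntegral_mono_on (hIntg A) (hIntg B) measurableSet_Ioi fun s hs => ?_
    have hs0 : (0 : ℝ) < s := hs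
    have hid : ∀ A : V → V → ℝ, ∑ u, ∑ v, jker p (f u - f v) s * A u v =
        s ^ (-1 - p) / 2 * (∑ u, ∑ v, (Real.cos (f u * s) - Real.cos (f v * s)) ^ 2 * A u v +
          ∑ u, ∑ v, (Real.sin (f u * s) - Real.sin (f v * s)) ^ 2 * A u v) := by
      intro A
      rw [← Finset.sum_add_distrib, Finset.mul_sum]
      refine Finset.sum_congr rfl fun u _ => ?_
      rw [← Finset.sum_add_distrib, Finset.mul_sum]
      refine Finset.sum_congr rfl fun v _ => ?_
      unfold jker
      rw [sub_mul (f u) (f v) s, Real.cos_sub]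
      have e1 := Real.sin_sq_add_cos_sq (f u * s)
      have e2 := Real.sin_sq_add_cos_sq (f v * s)
      linear_combination (-(s ^ (-1 - p) / 2 * A u v)) * (e1 + e2)
    rw [hid, hid]
    refine mul_le_mul_of_nonneg_left ?_ (by positivity)
    exact add_le_add (h2 fun u => Real.cos (f u * s)) (h2 fun u => Real.sin (f u * s))
  exact le_of_mul_le_mul_right hmain hJ

/-! ### Part E: from exponent two to exponents above two -/

/-- signed power -/
def spow (r t : ℝ) : ℝ := SignType.sign t * |t| ^ r

lemma spow_pos {r t : ℝ} (ht : 0 ≤ t) (hr : 0 < r) : spow r t = t ^ r := by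
  rcases ht.eq_or_lt with h | h
  · subst h; simp [spow, Real.zero_rpow hr.ne']
  · simp [spow, h, abs_of_pos h]

lemma spow_neg (r t : ℝ) : spow r (-t) = - spow r t := by
  simp [spow, Left.sign_neg]

lemma spow_cont (r : ℝ) (hr : 0 < r) : Continuous (spow r) := by
  have : spow r = fun t => (max t 0) ^ r - (max (-t) 0) ^ r := by
    funext t
    rcases le_total 0 t with h | h
    · rw [spow_pos h hr, max_eq_left h, max_eq_right (by linarith), Real.zero_rpow hr.ne', sub_zero]
    · have h' : spow r t = - spow r (-t) := by rw [spow_neg, neg_neg]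
      rw [h', spow_pos (by linarith) hr, max_eq_right h, max_eq_left (by linarith),
        Real.zero_rpow hr.ne', zero_sub]
  rw [this]
  refine Continuous.sub ?_ ?_
  · exact (continuous_id.max continuous_const).rpow_const fun _ => Or.inr hr.le
  · exact (continuous_neg.max continuous_const).rpow_const fun _ => Or.inr hr.le

lemma spow_sq (r t : ℝ) (hr : 0 < r) : spow r t ^ 2 = |t| ^ (2 * r) := by
  have h0 : 0 ≤ |t| ^ r := by positivity
  have h1 : |spow r t| = |t| ^ r := by
    rcases le_total 0 t with h | h
    · rw [spow_pos h hr, abs_of_nonneg h, abs_of_nonneg (by positivity)]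
    · have h' : spow r t = - spow r (-t) := by rw [spow_neg, neg_neg]
      rw [h', spow_pos (by linarith) hr, abs_neg, abs_of_nonpos h,
        abs_of_nonneg (Real.rpow_nonneg (by linarith) _)]
  rw [← sq_abs, h1, mul_comm, Real.rpow_mul (abs_nonneg t), Real.rpow_two]

lemma rpow_diff_le {r a b : ℝ} (hr : 1 < r) (hb : 0 ≤ b) (hab : b ≤ a) :
    a ^ r - b ^ r ≤ r * a ^ (r - 1) * (a - b) := by
  rcases (hb.trans hab).eq_or_lt with h | ha
  · have : b = 0 := by linarith
    subst this; subst h; simp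
  · have h1 := one_add_mul_self_le_rpow_one_add (s := b / a - 1)
      (by have : 0 ≤ b / a := by positivity
          linarith) hr.le
    rw [add_sub_cancel, Real.div_rpow hb ha.le, le_div_iff₀ (by positivity)] at h1
    have h2 : a ^ r = a ^ (r - 1) * a := by
      rw [← Real.rpow_add_one ha.ne']; congr 1; ring
    have h3 : (1 + r * (b / a - 1)) * a ^ r = a ^ r - r * a ^ (r - 1) * (a - b) := by
      rw [h2]; field_simp; ring
    linarith

lemma spow_diff {r a b M : ℝ} (hr : 1 < r) (ha : |a| ≤ M) (hb : |b| ≤ M) :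
    |spow r a - spow r b| ≤ r * M ^ (r - 1) * |a - b| := by
  have hr0 : 0 < r := by linarith
  have hM0 : 0 ≤ M := (abs_nonneg a).trans ha
  have hMM : 0 ≤ M ^ (r - 1) := Real.rpow_nonneg hM0 _
  -- nonnegative ordered case
  have key : ∀ a b : ℝ, 0 ≤ b → b ≤ a → a ≤ M →
      |spow r a - spow r b| ≤ r * M ^ (r - 1) * |a - b| := by
    intro a b hb hab haM
    rw [spow_pos hb hr0, spow_pos (hb.trans hab) hr0, abs_of_nonneg (a := a - b) (by linarith),
      abs_of_nonneg (sub_nonneg.mpr (Real.rpow_le_rpow hb hab hr0.le))]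
    refine (rpow_diff_le hr hb hab).trans (mul_le_mul_of_nonneg_right ?_ (by linarith))
    exact mul_le_mul_of_nonneg_left
      (Real.rpow_le_rpow (hb.trans hab) haM (by linarith)) hr0.le
  have key2 : ∀ a b : ℝ, 0 ≤ a → 0 ≤ b → a ≤ M → b ≤ M →
      |spow r a - spow r b| ≤ r * M ^ (r - 1) * |a - b| := by
    intro a b ha hb haM hbM
    rcases le_total b a with h | h
    · exact key a b hb h haM
    · rw [abs_sub_comm, abs_sub_comm a b]; exact key b a ha h hbM
  have single : ∀ t : ℝ, 0 ≤ t → t ≤ M → t ^ r ≤ r * M ^ (r - 1) * t := by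
    intro t ht htM
    have := key t 0 le_rfl ht htM
    rw [spow_pos ht hr0, spow_pos le_rfl hr0, Real.zero_rpow hr0.ne', sub_zero, sub_zero,
      abs_of_nonneg ht, abs_of_nonneg (by positivity)] at this
    exact this
  have key3 : ∀ a b : ℝ, 0 ≤ a → 0 ≤ b → a ≤ M → b ≤ M →
      |spow r a - spow r (-b)| ≤ r * M ^ (r - 1) * |a - (-b)| := by
    intro a b ha hb haM hbM
    rw [spow_neg, sub_neg_eq_add, sub_neg_eq_add, spow_pos ha hr0, spow_pos hb hr0,
      abs_of_nonneg (by positivity), abs_of_nonneg (by positivity)]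
    have := single a ha haM
    have := single b hb hbM
    linarith
  rw [abs_le] at ha hb
  rcases le_total 0 a with h | h <;> rcases le_total 0 b with h' | h'
  · exact key2 a b h h' ha.2 hb.2
  · have := key3 a (-b) h (by linarith) ha.2 (by linarith)
    rwa [neg_neg] at this
  · have := key3 b (-a) h' (by linarith) hb.2 (by linarith)
    rw [neg_neg] at this
    rwa [abs_sub_comm, abs_sub_comm a b]
  · have := key2 (-b) (-a) (by linarith) (by linarith) (by linarith) (by linarith)
    rw [spow_neg, spow_neg] at this
    convert this using 2
    · ring
    · ring_nf

lemma spow_mono_sign {r t : ℝ} (hr : 0 < r) (ht : 0 ≤ t) : 0 ≤ spow r t := by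
  rw [spow_pos ht hr]; positivity

lemma exists_center {V : Type*} [Fintype V] [Nonempty V] (π f : V → ℝ) (hπ : ∀ u, 0 ≤ π u)
    (r : ℝ) (hr : 0 < r) : ∃ c, ∑ u, π u * spow r (f u - c) = 0 := by
  obtain ⟨a, ha⟩ := Finite.exists_min f
  obtain ⟨b, hb⟩ := Finite.exists_max f
  have hc : Continuous fun c => ∑ u, π u * spow r (f u - c) := by
    refine continuous_finsetSum _ fun u _ => continuous_const.mul ?_
    exact (spow_cont r hr).comp (continuous_const.sub continuous_id)
  have h1 : 0 ≤ ∑ u, π u * spow r (f u - f a) :=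
    Finset.sum_nonneg fun u _ => mul_nonneg (hπ u) (spow_mono_sign hr (by linarith [ha u]))
  have h2 : ∑ u, π u * spow r (f u - f b) ≤ 0 :=
    Finset.sum_nonpos fun u _ => by
      have e : f u - f b = -(f b - f u) := by ring
      rw [e, spow_neg]
      have := mul_nonneg (hπ u) (spow_mono_sign hr (t := f b - f u) (by linarith [hb u]))
      linarith
  exact mem_range_of_exists_le_of_exists_ge hc ⟨f b, h2⟩ ⟨f a, h1⟩

lemma young_term (p x y t S : ℝ) (hp : 2 < p) (hx : 0 ≤ x) (hy : 0 ≤ y) (ht : 0 < t)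
    (hS : 0 < S) :
    x ^ 2 * y ^ (p - 2) ≤ t ^ (2 / p) * S ^ (1 - 2 / p) *
      (2 / p * (x ^ p / t) + (1 - 2 / p) * (y ^ p / S)) := by
  have hp0 : 0 < p := by linarith
  have h1 : 2 / p < 1 := by rw [div_lt_one hp0]; exact hp
  have h := Real.geom_mean_le_arith_mean2_weighted (w₁ := 2 / p) (w₂ := 1 - 2 / p)
    (p₁ := x ^ p / t) (p₂ := y ^ p / S) (by positivity) (by linarith) (by positivity)
    (by positivity) (by ring)
  rw [Real.div_rpow (by positivity) ht.le, Real.div_rpow (by positivity) hS.le,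
    ← Real.rpow_mul hx, ← Real.rpow_mul hy, show p * (2 / p) = 2 by field_simp,
    show p * (1 - 2 / p) = p - 2 by field_simp, Real.rpow_two] at h
  have ht' : 0 < t ^ (2 / p) := by positivity
  have hS' : 0 < S ^ (1 - 2 / p) := by positivity
  calc x ^ 2 * y ^ (p - 2) = t ^ (2 / p) * S ^ (1 - 2 / p) *
      (x ^ 2 / t ^ (2 / p) * (y ^ (p - 2) / S ^ (1 - 2 / p))) := by field_simp
    _ ≤ _ := mul_le_mul_of_nonneg_left h (by positivity)

lemma extrap_gt {V : Type*} [Fintype V] [Nonempty V] (π : V → ℝ) (q : V → V → ℝ) (K : ℝ)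
    (hK : 0 ≤ K) (hπ : ∀ u, 0 ≤ π u) (hπ1 : ∑ u, π u = 1) (hq : ∀ u v, 0 ≤ q u v)
    (hsym : ∀ u v, q u v = q v u) (hrow : ∀ u, ∑ v, q u v ≤ π u)
    (h2 : ∀ f : V → ℝ, ∑ u, ∑ v, (f u - f v) ^ 2 * (π u * π v) ≤
      K * ∑ u, ∑ v, (f u - f v) ^ 2 * q u v)
    (p : ℝ) (hp : 2 < p) (f : V → ℝ) :
    ∑ u, ∑ v, |f u - f v| ^ p * (π u * π v) ≤
      K ^ (p / 2) * (2 * p) ^ p * ∑ u, ∑ v, |f u - f v| ^ p * q u v := by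
  have hp0 : 0 < p := by linarith
  set r := p / 2 with hr
  have hr1 : 1 < r := by rw [hr]; linarith
  have hr0 : 0 < r := by linarith
  obtain ⟨c, hc⟩ := exists_center π f hπ r hr0
  set g : V → ℝ := fun u => spow r (f u - c) with hg
  set S := ∑ u, π u * |f u - c| ^ p with hS
  set E := ∑ u, ∑ v, |f u - f v| ^ p * q u v with hE
  have hE0 : 0 ≤ E := Finset.sum_nonneg fun u _ => Finset.sum_nonneg fun v _ =>
    mul_nonneg (by positivity) (hq u v)
  have hS0 : 0 ≤ S := Finset.sum_nonneg fun u _ => mul_nonneg (hπ u) (by positivity)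
  have hgsq : ∀ u, g u ^ 2 = |f u - c| ^ p := by
    intro u
    simp only [hg]
    rw [spow_sq r _ hr0]; congr 1; rw [hr]; ring
  have hvar : ∑ u, ∑ v, (g u - g v) ^ 2 * (π u * π v) = 2 * S := by
    have e : ∀ u v, (g u - g v) ^ 2 * (π u * π v) =
        (π u * |f u - c| ^ p) * π v + π u * (π v * |f v - c| ^ p) -
          2 * ((π u * g u) * (π v * g v)) := by
      intro u v
      rw [← hgsq, ← hgsq]; ring
    simp only [e, Finset.sum_sub_distrib, Finset.sum_add_distrib, ← Finset.mul_sum,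
      ← Finset.sum_mul]
    rw [hc, hπ1]
    ring
  -- main estimate
  have hT : S ≤ K * r ^ 2 * ∑ u, ∑ v, |f u - f v| ^ 2 * |f u - c| ^ (p - 2) * q u v := by
    have h3 := h2 g
    rw [hvar] at h3
    have h4 : ∀ u v, (g u - g v) ^ 2 * q u v ≤
        r ^ 2 * (|f u - f v| ^ 2 * |f u - c| ^ (p - 2) * q u v) +
          r ^ 2 * (|f v - f u| ^ 2 * |f v - c| ^ (p - 2) * q v u) := by
      intro u v
      set M := max |f u - c| |f v - c| with hM
      have hM0 : 0 ≤ M := (abs_nonneg _).trans (le_max_left _ _)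
      have h5 := spow_diff hr1 (le_max_left |f u - c| |f v - c|) (le_max_right _ _)
      rw [← hM, sub_sub_sub_cancel_right] at h5
      have h6 : (g u - g v) ^ 2 ≤ (r * M ^ (r - 1) * |f u - f v|) ^ 2 := by
        rw [← sq_abs (g u - g v)]
        exact pow_le_pow_left₀ (abs_nonneg _) h5 2
      have h7 : (M ^ (r - 1)) ^ 2 ≤ |f u - c| ^ (p - 2) + |f v - c| ^ (p - 2) := by
        have e : (M ^ (r - 1)) ^ 2 = M ^ (p - 2) := by
          rw [← Real.rpow_two, ← Real.rpow_mul hM0]; congr 1; rw [hr]; ring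
        rw [e]
        have := Real.rpow_nonneg (abs_nonneg (f u - c)) (p - 2)
        have := Real.rpow_nonneg (abs_nonneg (f v - c)) (p - 2)
        rcases max_choice |f u - c| |f v - c| with h | h <;> rw [hM, h] <;> linarith
      rw [hsym v u, abs_sub_comm (f v) (f u)]
      calc (g u - g v) ^ 2 * q u v ≤ (r * M ^ (r - 1) * |f u - f v|) ^ 2 * q u v :=
            mul_le_mul_of_nonneg_right h6 (hq u v)
        _ = r ^ 2 * |f u - f v| ^ 2 * q u v * (M ^ (r - 1)) ^ 2 := by ring
        _ ≤ r ^ 2 * |f u - f v| ^ 2 * q u v * (|f u - c| ^ (p - 2) + |f v - c| ^ (p - 2)) :=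
            mul_le_mul_of_nonneg_left h7 (mul_nonneg (by positivity) (hq u v))
        _ = _ := by ring
    have h8 := Finset.sum_le_sum fun u (_ : u ∈ Finset.univ) =>
      Finset.sum_le_sum fun v (_ : v ∈ Finset.univ) => h4 u v
    simp only [Finset.sum_add_distrib] at h8
    rw [Finset.sum_comm (f := fun u v => r ^ 2 * (|f v - f u| ^ 2 * |f v - c| ^ (p - 2) * q v u))]
      at h8
    simp only [← Finset.mul_sum] at h8
    have h9 := mul_le_mul_of_nonneg_left h8 hK
    linarith
  have hSt : ∀ t, 0 < t → E ≤ t → S ≤ K ^ (p / 2) * r ^ p * t := by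
    intro t ht hEt
    rcases hS0.eq_or_lt with h0 | hSpos
    · rw [← h0]; positivity
    have hp1 : 2 / p < 1 := by rw [div_lt_one hp0]; exact hp
    have h5 : ∑ u, ∑ v, |f u - f v| ^ 2 * |f u - c| ^ (p - 2) * q u v ≤
        t ^ (2 / p) * S ^ (1 - 2 / p) * (2 / p * (E / t) +
          (1 - 2 / p) * ((∑ u, ∑ v, |f u - c| ^ p * q u v) / S)) := by
      have e : t ^ (2 / p) * S ^ (1 - 2 / p) * (2 / p * (E / t) +
          (1 - 2 / p) * ((∑ u, ∑ v, |f u - c| ^ p * q u v) / S)) =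
          ∑ u, ∑ v, t ^ (2 / p) * S ^ (1 - 2 / p) * (2 / p * (|f u - f v| ^ p / t) +
            (1 - 2 / p) * (|f u - c| ^ p / S)) * q u v := by
        rw [hE]
        simp only [Finset.sum_div, Finset.mul_sum, ← Finset.sum_add_distrib]
        refine Finset.sum_congr rfl fun u _ => Finset.sum_congr rfl fun v _ => ?_
        ring
      rw [e]
      refine Finset.sum_le_sum fun u _ => Finset.sum_le_sum fun v _ => ?_
      exact mul_le_mul_of_nonneg_right
        (young_term p _ _ t S hp (abs_nonneg _) (abs_nonneg _) ht hSpos) (hq u v)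
    have h6 : ∑ u, ∑ v, |f u - c| ^ p * q u v ≤ S := by
      refine Finset.sum_le_sum fun u _ => ?_
      rw [← Finset.mul_sum, mul_comm (π u)]
      exact mul_le_mul_of_nonneg_left (hrow u) (by positivity)
    have h7 : 2 / p * (E / t) +
          (1 - 2 / p) * ((∑ u, ∑ v, |f u - c| ^ p * q u v) / S) ≤ 1 := by
      have a1 : E / t ≤ 1 := (div_le_one ht).mpr hEt
      have a2 : (∑ u, ∑ v, |f u - c| ^ p * q u v) / S ≤ 1 := (div_le_one hSpos).mpr h6
      have a3 : 0 < 2 / p := by positivity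
      nlinarith
    have h8 : S ≤ K * r ^ 2 * (t ^ (2 / p) * S ^ (1 - 2 / p)) := by
      refine hT.trans (mul_le_mul_of_nonneg_left ?_ (by positivity))
      refine h5.trans ?_
      have := mul_le_mul_of_nonneg_left h7
        (by positivity : (0 : ℝ) ≤ t ^ (2 / p) * S ^ (1 - 2 / p))
      linarith
    have h9 : S ^ (2 / p) ≤ K * r ^ 2 * t ^ (2 / p) := by
      have hSS : 0 < S ^ (1 - 2 / p) := by positivity
      have e : S = S ^ (2 / p) * S ^ (1 - 2 / p) := by
        rw [← Real.rpow_add hSpos, add_sub_cancel, Real.rpow_one]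
      refine le_of_mul_le_mul_right ?_ hSS
      rw [← e]
      linarith
    have h10 := Real.rpow_le_rpow (by positivity) h9 hr0.le
    rw [← Real.rpow_mul hS0, Real.mul_rpow (by positivity) (by positivity),
      Real.mul_rpow hK (by positivity), ← Real.rpow_mul ht.le, ← Real.rpow_two,
      ← Real.rpow_mul hr0.le, show 2 / p * r = 1 by rw [hr]; field_simp,
      show 2 * r = p by rw [hr]; ring, Real.rpow_one, Real.rpow_one] at h10
    exact h10
  have hSE : S ≤ K ^ (p / 2) * r ^ p * E := by
    have hlim : Filter.Tendsto (fun t => K ^ (p / 2) * r ^ p * t)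
        (nhdsWithin E (Set.Ioi E)) (nhds (K ^ (p / 2) * r ^ p * E)) :=
      ((continuous_const.mul continuous_id).tendsto E).mono_left nhdsWithin_le_nhds
    refine ge_of_tendsto hlim ?_
    filter_upwards [self_mem_nhdsWithin] with t ht
    exact hSt t (lt_of_le_of_lt hE0 ht) (le_of_lt ht)
  have hfin : ∑ u, ∑ v, |f u - f v| ^ p * (π u * π v) ≤ 2 ^ p * (2 * S) := by
    have e : 2 ^ p * (2 * S) = ∑ u, ∑ v, 2 ^ p * (|f u - c| ^ p + |f v - c| ^ p) * (π u * π v) := by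
      have e1 : ∀ u v, 2 ^ p * (|f u - c| ^ p + |f v - c| ^ p) * (π u * π v) =
          2 ^ p * ((π u * |f u - c| ^ p) * π v) + 2 ^ p * (π u * (π v * |f v - c| ^ p)) := by
        intro u v; ring
      simp only [e1, Finset.sum_add_distrib, ← Finset.mul_sum, ← Finset.sum_mul]
      rw [hπ1]
      ring
    rw [e]
    refine Finset.sum_le_sum fun u _ => Finset.sum_le_sum fun v _ => ?_
    refine mul_le_mul_of_nonneg_right ?_ (mul_nonneg (hπ u) (hπ v))
    set M := max |f u - c| |f v - c| with hM
    have hM0 : 0 ≤ M := (abs_nonneg _).trans (le_max_left _ _)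
    have h5 : |f u - f v| ≤ 2 * M := by
      have h6 : |f u - f v| ≤ |f u - c| + |f v - c| := by
        rw [abs_sub_comm (f v) c]; exact abs_sub_le _ _ _
      have := le_max_left |f u - c| |f v - c|
      have := le_max_right |f u - c| |f v - c|
      linarith
    have h6 := Real.rpow_le_rpow (abs_nonneg _) h5 hp0.le
    rw [Real.mul_rpow (by norm_num) hM0] at h6
    refine h6.trans (mul_le_mul_of_nonneg_left ?_ (by positivity))
    have := Real.rpow_nonneg (abs_nonneg (f u - c)) p
    have := Real.rpow_nonneg (abs_nonneg (f v - c)) p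
    rcases max_choice |f u - c| |f v - c| with h | h <;> rw [hM, h] <;> linarith
  refine hfin.trans ?_
  have hKp : 0 ≤ K ^ (p / 2) := by positivity
  have e1 : (2 * p) ^ p = 2 ^ p * (2 ^ p * r ^ p) := by
    rw [← Real.mul_rpow (by norm_num) hr0.le, ← Real.mul_rpow (by norm_num) (by positivity)]
    congr 1
    rw [hr]; ring
  have h2p : (2 : ℝ) ≤ 2 ^ p := by
    calc (2 : ℝ) = 2 ^ (1 : ℝ) := (Real.rpow_one 2).symm
      _ ≤ _ := Real.rpow_le_rpow_of_exponent_le (by norm_num) (by linarith)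
  rw [e1]
  calc (2 : ℝ) ^ p * (2 * S) ≤ 2 ^ p * (2 ^ p * (K ^ (p / 2) * r ^ p * E)) := by
        refine mul_le_mul_of_nonneg_left ?_ (by positivity)
        exact mul_le_mul h2p hSE hS0 (by positivity)
    _ = _ := by ring

/-! ### Part F: passage to `ℓ^p` and conclusion -/

lemma lp_lift {V : Type*} [Fintype V] (p : ℝ) (hp : 0 < p) (A B : V → V → ℝ) (D : ℝ)
    (h : ∀ f : V → ℝ, ∑ u, ∑ v, |f u - f v| ^ p * A u v ≤
      D * ∑ u, ∑ v, |f u - f v| ^ p * B u v)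
    (F : V → lp (fun _ : ℕ => ℝ) (ENNReal.ofReal p)) :
    ∑ u, ∑ v, ‖F u - F v‖ ^ p * A u v ≤ D * ∑ u, ∑ v, ‖F u - F v‖ ^ p * B u v := by
  have hpr : (ENNReal.ofReal p).toReal = p := ENNReal.toReal_ofReal hp.le
  have hs : ∀ A : V → V → ℝ, HasSum (fun i : ℕ => ∑ u, ∑ v, |F u i - F v i| ^ p * A u v)
      (∑ u, ∑ v, ‖F u - F v‖ ^ p * A u v) := by
    intro A
    refine hasSum_sum fun u _ => hasSum_sum fun v _ => ?_
    have h1 := lp.hasSum_norm (by rw [hpr]; exact hp) (F u - F v)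
    rw [hpr] at h1
    exact h1.mul_right _
  exact hasSum_le (fun i => h fun u => F u i) (hs A) ((hs B).mul_left D)

theorem statement18 :
    ∃ C : ℝ, 0 < C ∧
      ∀ m : ℕ, 2 ≤ m →
      ∀ (p : ℝ) (F : Lamp m → lp (fun _ : ℕ => ℝ) (ENNReal.ofReal p)),
        (1 ≤ p → p ≤ 2 →
          ∑ u, ∑ v, ‖F u - F v‖ ^ p * Um m u * Um m v ≤
            C * m * Real.log m *
              ∑ u, ∑ v, ‖F u - F v‖ ^ p * Um m u * pker m u v) ∧
        (2 < p →
          ∑ u, ∑ v, ‖F u - F v‖ ^ p * Um m u * Um m v ≤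
            (C * m * Real.log m) ^ (p / 2) * (2 * p) ^ p *
              ∑ u, ∑ v, ‖F u - F v‖ ^ p * Um m u * pker m u v) := by
  refine ⟨12000, by norm_num, fun m hm p F => ?_⟩
  have hl : 0 ≤ Real.log m := Real.log_nonneg (by exact_mod_cast (by omega : 1 ≤ m))
  have hK : (0 : ℝ) ≤ 12000 * m * Real.log m := by positivity
  have h2 : ∀ f : Lamp m → ℝ, ∑ u, ∑ v, (f u - f v) ^ 2 * (Um m u * Um m v) ≤
      12000 * m * Real.log m * ∑ u, ∑ v, (f u - f v) ^ 2 * (Um m u * pker m u v) := by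
    intro f
    have := poincare_two m hm f
    simpa only [mul_assoc] using this
  constructor
  · intro hp1 hp2
    have hreal : ∀ f : Lamp m → ℝ, ∑ u, ∑ v, |f u - f v| ^ p * (Um m u * Um m v) ≤
        12000 * m * Real.log m * ∑ u, ∑ v, |f u - f v| ^ p * (Um m u * pker m u v) := by
      intro f
      rcases hp2.eq_or_lt with h | h
      · subst h
        simp only [Real.rpow_two, sq_abs]
        exact h2 f
      · have e : ∀ T : Lamp m → Lamp m → ℝ,
            12000 * m * Real.log m * ∑ u, ∑ v, T u v * (Um m u * pker m u v) =
            ∑ u, ∑ v, T u v * (12000 * m * Real.log m * (Um m u * pker m u v)) := by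
          intro T
          rw [Finset.mul_sum]
          refine Finset.sum_congr rfl fun u _ => ?_
          rw [Finset.mul_sum]
          refine Finset.sum_congr rfl fun v _ => by ring
        rw [e]
        refine extrap_lt _ _ (fun g => ?_) p (by linarith) h f
        rw [← e fun u v => (g u - g v) ^ 2]
        exact h2 g
    have := lp_lift p (by linarith) _ _ _ hreal F
    simpa only [← mul_assoc] using this
  · intro hp
    have : Nonempty (Lamp m) := ⟨(fun _ => false, ⟨0, by omega⟩)⟩
    have := lp_lift p (by linarith) _ _ _ (extrap_gt (Um m) (fun u v => Um m u * pker m u v)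
      (12000 * m * Real.log m) hK (Um_nonneg m hm) (Um_sum m hm)
      (fun u v => mul_nonneg (Um_nonneg m hm u) (pker_nonneg m u v)) (rev_pker m)
      (fun u => ?_) h2 p hp) F
    · simpa only [← mul_assoc] using this
    · rw [← Finset.mul_sum]
      exact mul_le_of_le_one_right (Um_nonneg m hm u) (pker_row m u)

end
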